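/- Let n ≥ 1 and m ≥ 2 be integers, α, β > 0 real with α = 2β, and 1 ≤ p ≤ (2m+2)/(m+3). Set a = 2n(1/p − 1/2) − 1 and b = 2(n+m)(1/p − 1/2) − 1. For μ > 0 let λ_k(μ) be the unique positive real λ with (2k+n)^α λ^α + λ^{2β} = μ, and set λ_k'(μ) = 1/(α(2k+n)^α λ_k(μ)^{α−1} + 2β λ_k(μ)^{2β−1}). Then there exists a constant C > 0, depending only on n, m, p, α, such that for every μ > 0 the series ∑_{k=0}^∞ (2k+n)^a · λ_k(μ)^b · λ_k'(μ) converges and is at most C · μ^{(2/α)(n+m)(1/p−1/2) − 1}. -/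

import Mathlib

/-- If `(N x)^α + x^α = μ`, the corresponding term of the series is bounded by
`μ^(q/α - 1) N^(a - q) / α`, where `q` is one more than the exponent of `x`. -/
theorem series_term_le {α N x μ a q : ℝ} (hα : 0 < α) (hN : 0 < N) (hx : 0 < x) (hμ : 0 < μ)
    (hq : 0 ≤ q) (h : N ^ α * x ^ α + x ^ α = μ) :
    N ^ a * x ^ (q - 1) * (1 / (α * N ^ α * x ^ (α - 1) + α * x ^ (α - 1))) ≤
      1 / α * μ ^ (q / α - 1) * N ^ (a - q) := by
  have hden : α * N ^ α * x ^ (α - 1) + α * x ^ (α - 1) = α * μ / x := by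
    rw [Real.rpow_sub_one hx.ne', ← h]
    ring
  have hpow : N ^ q * x ^ q ≤ μ ^ (q / α) := by
    have hle : N ^ α * x ^ α ≤ μ := by
      have := Real.rpow_pos_of_pos hx α
      linarith
    calc N ^ q * x ^ q = (N ^ α * x ^ α) ^ (q / α) := by
          rw [← Real.mul_rpow hN.le hx.le, ← Real.mul_rpow hN.le hx.le,
            ← Real.rpow_mul (by positivity), mul_div_cancel₀ _ hα.ne']
      _ ≤ μ ^ (q / α) := Real.rpow_le_rpow (by positivity) hle (by positivity)
  rw [hden, Real.rpow_sub_one hx.ne', Real.rpow_sub_one hμ.ne', Real.rpow_sub hN]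
  calc N ^ a * (x ^ q / x) * (1 / (α * μ / x))
      = N ^ a / (α * μ * N ^ q) * (N ^ q * x ^ q) := by
        have := (Real.rpow_pos_of_pos hN q).ne'
        field_simp
    _ ≤ N ^ a / (α * μ * N ^ q) * μ ^ (q / α) := by gcongr
    _ = 1 / α * (μ ^ (q / α) / μ) * (N ^ a / N ^ q) := by
        field_simp

/-- The series `∑ (2k+n)^s` converges for `s < -1`. -/
theorem summable_two_mul_add_rpow {n : ℕ} (hn : 1 ≤ n) {s : ℝ} (hs : s < -1) :
    Summable fun k : ℕ => (2 * k + n : ℝ) ^ s := by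
  have hn' : (1 : ℝ) ≤ n := by exact_mod_cast hn
  refine Summable.of_nonneg_of_le (fun k => by positivity) (fun k => ?_)
    ((summable_nat_add_iff 1).2 (Real.summable_nat_rpow.2 hs))
  refine Real.rpow_le_rpow_of_nonpos (by positivity) ?_ (by linarith)
  push_cast
  have : (0 : ℝ) ≤ k := k.cast_nonneg
  linarith


/-- (case `α = 2β`, `μ > 0`) Bound for the series
`∑_k (2k+n)^a (lam k μ)^b (lam k μ)'` by `C μ^((2/α)(n+m)(1/p−1/2) − 1)`. -/
theorem stmt12 (n m : ℕ) (hn : 1 ≤ n) (hm : 2 ≤ m) (α β : ℝ) (hα : 0 < α) (hβ : 0 < β)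
    (hαβ : α = 2 * β) (p : ℝ) (hp1 : 1 ≤ p) (hp2 : p ≤ (2 * m + 2) / (m + 3))
    (lam : ℕ → ℝ → ℝ)
    (hlam : ∀ k : ℕ, ∀ μ : ℝ, 0 < μ → 0 < lam k μ ∧
      (2 * k + n : ℝ) ^ α * (lam k μ) ^ α + (lam k μ) ^ (2 * β) = μ) :
    ∃ C : ℝ, 0 < C ∧ ∀ μ : ℝ, 0 < μ →
      Summable (fun k : ℕ =>
        (2 * k + n : ℝ) ^ (2 * n * (1 / p - 1 / 2) - 1) *
          (lam k μ) ^ (2 * (n + m : ℝ) * (1 / p - 1 / 2) - 1) *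
          (1 / (α * (2 * k + n : ℝ) ^ α * (lam k μ) ^ (α - 1) +
                2 * β * (lam k μ) ^ (2 * β - 1)))) ∧
      (∑' k : ℕ,
        (2 * k + n : ℝ) ^ (2 * n * (1 / p - 1 / 2) - 1) *
          (lam k μ) ^ (2 * (n + m : ℝ) * (1 / p - 1 / 2) - 1) *
          (1 / (α * (2 * k + n : ℝ) ^ α * (lam k μ) ^ (α - 1) +
                2 * β * (lam k μ) ^ (2 * β - 1))))
        ≤ C * μ ^ ((2 / α) * (n + m : ℝ) * (1 / p - 1 / 2) - 1) := by
  subst hαβ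
  have hn' : (1 : ℝ) ≤ n := by exact_mod_cast hn
  have hm' : (2 : ℝ) ≤ m := by exact_mod_cast hm
  have hd : 0 < 1 / p - 1 / 2 := by
    have hp : p < 2 := hp2.trans_lt (by rw [div_lt_iff₀ (by positivity)]; linarith)
    exact sub_pos.2 (one_div_lt_one_div_of_lt (by linarith) hp)
  have hsum := summable_two_mul_add_rpow hn
    (s := 2 * n * (1 / p - 1 / 2) - 1 - 2 * (n + m : ℝ) * (1 / p - 1 / 2)) (by
      have : 0 < m * (1 / p - 1 / 2) := by positivity
      linarith)
  have hterm (μ : ℝ) (hμ : 0 < μ) (k : ℕ) :=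
    series_term_le (a := 2 * n * (1 / p - 1 / 2) - 1) (q := 2 * (n + m : ℝ) * (1 / p - 1 / 2))
      hα (show (0 : ℝ) < 2 * k + n by positivity) (hlam k μ hμ).1 hμ (by positivity)
      (hlam k μ hμ).2
  refine ⟨1 / (2 * β) * ∑' k : ℕ,
    (2 * k + n : ℝ) ^ (2 * n * (1 / p - 1 / 2) - 1 - 2 * (n + m : ℝ) * (1 / p - 1 / 2)),
    mul_pos (by positivity) (hsum.tsum_pos (fun k => by positivity) 0 (by positivity)),
    fun μ hμ => ?_⟩
  have hmaj := hsum.mul_left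
    (1 / (2 * β) * μ ^ (2 * (n + m : ℝ) * (1 / p - 1 / 2) / (2 * β) - 1))
  have hs := Summable.of_nonneg_of_le (fun k => by
    have := (hlam k μ hμ).1
    positivity) (hterm μ hμ) hmaj
  refine ⟨hs, (hs.tsum_le_tsum (hterm μ hμ) hmaj).trans_eq ?_⟩
  rw [tsum_mul_left, show 2 / (2 * β) * (n + m : ℝ) * (1 / p - 1 / 2) - 1 =
    2 * (n + m : ℝ) * (1 / p - 1 / 2) / (2 * β) - 1 by ring]
  ring
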